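/- arXiv:2406.17247 — 6 statements merged into one kernel-verified Lean document; each statement's English description precedes it below -/
import Mathlib

section
/- Let n ≥ 1, let v_α ∈ ℂ^d be nonzero vectors and p_α > 0 real weights for α ∈ Fin n. Then the positive semidefinite matrix ∑_{α ∈ Fin n} p_α • (v_α v_α†) has rank one if and only if all the vectors v_α are pairwise linearly dependent (i.e., for all α, α′ there exists c ∈ ℂ with v_α = c • v_{α′}). -/
open Matrix BigOperators ComplexOrder

noncomputable section

/-- The outer product `v v†` of a vector with itself:
`(outerProd v) j k = v j * conj (v k)`. -/
def outerProd {d : Type*} [Fintype d] (v : d → ℂ) : Matrix d d ℂ :=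
  fun j k => v j * (starRingEnd ℂ) (v k)

open Submodule in
/-- A nonempty family of nonzero vectors spans a line if and only if its members are pairwise
proportional. -/
theorem finrank_span_range_eq_one_iff {K V ι : Type*} [Field K] [AddCommGroup V] [Module K V]
    [Nonempty ι] {w : ι → V} (hw : ∀ i, w i ≠ 0) :
    Module.finrank K (span K (Set.range w)) = 1 ↔ ∀ i j, ∃ c : K, w i = c • w j := by
  constructor
  · intro h i j
    have hmem (k : ι) : w k ∈ span K (Set.range w) := subset_span ⟨k, rfl⟩
    have hj : (⟨w j, hmem j⟩ : span K (Set.range w)) ≠ 0 := fun h0 => hw j (congrArg Subtype.val h0)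
    obtain ⟨c, hc⟩ := (finrank_eq_one_iff_of_nonzero' _ hj).1 h ⟨w i, hmem i⟩
    exact ⟨c, (congrArg Subtype.val hc).symm⟩
  · intro h
    obtain ⟨j⟩ := ‹Nonempty ι›
    have hspan : span K (Set.range w) = span K {w j} := by
      refine le_antisymm (span_le.2 ?_) (span_mono (by simp))
      rintro _ ⟨i, rfl⟩
      obtain ⟨c, hc⟩ := h i j
      exact mem_span_singleton.2 ⟨c, hc.symm⟩
    rw [hspan, finrank_span_singleton (hw j)]

/-- A nonnegatively weighted sum of outer products has the rank of the family of rescaled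
vectors. -/
theorem rank_sum_smul_outerProd {d ι : Type*} [Fintype d] [Fintype ι] (v : ι → d → ℂ)
    {p : ι → ℝ} (hp : ∀ i, 0 ≤ p i) :
    (∑ i, p i • outerProd (v i)).rank =
      Module.finrank ℂ (Submodule.span ℂ (Set.range fun i => (√(p i) : ℂ) • v i)) := by
  let B : Matrix d ι ℂ := Matrix.of fun j i => (√(p i) : ℂ) * v i j
  have hB : ∑ i, p i • outerProd (v i) = B * Bᴴ := by
    ext j k
    simp only [Matrix.sum_apply, Matrix.smul_apply, outerProd, Matrix.mul_apply,
      Matrix.conjTranspose_apply, B, Matrix.of_apply, Complex.real_smul]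
    refine Finset.sum_congr rfl fun i _ => ?_
    have hs : ((√(p i) : ℝ) : ℂ) * (√(p i) : ℝ) = p i := by
      rw [← Complex.ofReal_mul, Real.mul_self_sqrt (hp i)]
    rw [star_mul', ← starRingEnd_apply, ← starRingEnd_apply, Complex.conj_ofReal, ← hs]
    ring
  rw [hB, Matrix.rank_self_mul_conjTranspose, Matrix.rank_eq_finrank_span_cols]
  rfl

/-- A positively weighted mixture `∑ α, p α • v_α v_α†` of nonzero pure states has
rank one if and only if all the vectors `v_α` are pairwise linearly dependent. -/
theorem mixture_rank_one_iff_pairwise_dependent {d n : ℕ} (hn : 1 ≤ n)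
    (v : Fin n → Fin d → ℂ) (hv : ∀ α, v α ≠ 0)
    (p : Fin n → ℝ) (hp : ∀ α, 0 < p α) :
    (∑ α, p α • outerProd (v α)).rank = 1 ↔
      ∀ α α', ∃ c : ℂ, v α = c • v α' := by
  have : Nonempty (Fin n) := ⟨⟨0, hn⟩⟩
  have hs (α : Fin n) : (√(p α) : ℂ) ≠ 0 :=
    Complex.ofReal_ne_zero.2 (Real.sqrt_pos.2 (hp α)).ne'
  rw [rank_sum_smul_outerProd v fun α => (hp α).le,
    finrank_span_range_eq_one_iff fun α => smul_ne_zero (hs α) (hv α)]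
  refine forall₂_congr fun α α' => ⟨?_, ?_⟩
  · rintro ⟨c, hc⟩
    refine ⟨(√(p α) : ℂ)⁻¹ * (c * √(p α')), ?_⟩
    rw [mul_smul, mul_smul, ← hc, inv_smul_smul₀ (hs α)]
  · rintro ⟨c, hc⟩
    refine ⟨√(p α) * c * (√(p α') : ℂ)⁻¹, ?_⟩
    rw [mul_smul, inv_smul_smul₀ (hs α'), mul_smul, ← hc]

end
end

section
/- Let ρ_B be a density matrix on ℂ^d, let K₁, K₂ ≥ 1, and let τ : Fin K₁ → Matrix (Fin d) (Fin d) ℂ and σ : Fin K₂ → Matrix (Fin d) (Fin d) ℂ be families of positive semidefinite matrices with ∑_a τ_a = ρ_B and ∑_b σ_b = ρ_B. Assume the pure state requirement: every τ_a and every σ_b is nonzero and has rank one. Assume the measurement requirement: for all a ∈ Fin K₁ and b ∈ Fin K₂ there is no real c > 0 with τ_a = c • σ_b. Then there exists no local-hidden-state model for (τ, σ). (This is the EPR steering paradox '2 = 1': an LHS model would force ∑_a tr τ_a + ∑_b tr σ_b = 2 to equal tr(∑_ξ ℘_ξ ρ_ξ) = 1. Note that no distinctness is assumed among the τ_a themselves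 or among the σ_b themselves, so the conclusion also covers the case, treated in Appendix A, where two conditional states within the same measurement setting coincide.) -/
open Matrix BigOperators ComplexOrder

noncomputable section

/-- A local-hidden-state (LHS) model for two families of (unnormalized) conditional
states `τ : Fin K₁ → Matrix B B ℂ` and `σ : Fin K₂ → Matrix B B ℂ`:
an ensemble of density matrices `ρ ξ` with weights `w ξ` and conditional
probability distributions `p₁`, `p₂` reproducing `τ` and `σ`. -/
def IsLHSModel {B : Type*} [Fintype B] [DecidableEq B] {K₁ K₂ : ℕ}
    (τ : Fin K₁ → Matrix B B ℂ) (σ : Fin K₂ → Matrix B B ℂ) : Prop :=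
  ∃ (L : ℕ) (ρ : Fin L → Matrix B B ℂ) (w : Fin L → ℝ)
    (p₁ : Fin K₁ → Fin L → ℝ) (p₂ : Fin K₂ → Fin L → ℝ),
    (∀ ξ, (ρ ξ).PosSemidef) ∧ (∀ ξ, (ρ ξ).trace = 1) ∧
    (∀ ξ, w ξ ∈ Set.Icc (0 : ℝ) 1) ∧ (∑ ξ, w ξ = 1) ∧
    (∀ a ξ, p₁ a ξ ∈ Set.Icc (0 : ℝ) 1) ∧
    (∀ b ξ, p₂ b ξ ∈ Set.Icc (0 : ℝ) 1) ∧
    (∀ ξ, ∑ a, p₁ a ξ = 1) ∧ (∀ ξ, ∑ b, p₂ b ξ = 1) ∧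
    (∀ a, τ a = ∑ ξ, (p₁ a ξ * w ξ) • ρ ξ) ∧
    (∀ b, σ b = ∑ ξ, (p₂ b ξ * w ξ) • ρ ξ)

/-- A Hermitian matrix of the form `r cᵀ` is a multiple of `c̄ cᵀ`. -/
theorem Matrix.IsHermitian.exists_eq_smul_vecMulVec_star {n : Type*} {H : Matrix n n ℂ}
    (hH : H.IsHermitian) {r c : n → ℂ} (h : H = vecMulVec r c) :
    ∃ s : ℂ, H = s • vecMulVec (star c) c := by
  by_cases hc : ∃ j, c j ≠ 0
  · obtain ⟨j, hj⟩ := hc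
    refine ⟨star (r j) / c j, ?_⟩
    ext i k
    have hij : r i * c j = star (r j) * star (c i) := by
      have := hH.apply i j
      simp only [h, vecMulVec_apply, star_mul'] at this
      exact this.symm
    have hri : r i = star (r j) / c j * star (c i) := by
      field_simp
      exact hij
    simp only [h, smul_apply, vecMulVec_apply, Pi.star_apply, smul_eq_mul]
    rw [hri, mul_assoc]
  · push Not at hc
    refine ⟨0, ?_⟩
    ext i k
    simp [h, vecMulVec_apply, hc]

/-- A Hermitian matrix of trace one whose kernel contains that of a Hermitian rank-one matrix `A`
is the normalization of `A`. -/
theorem Matrix.IsHermitian.eq_trace_smul_of_rank_eq_one {n : Type*} [Fintype n] [DecidableEq n]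
    {A R : Matrix n n ℂ} (hA : A.IsHermitian) (hR : R.IsHermitian) (hrank : A.rank = 1)
    (htr : R.trace = 1) (hker : ∀ x, A *ᵥ x = 0 → R *ᵥ x = 0) :
    A = A.trace • R := by
  obtain ⟨⟨_, x₀, rfl⟩, -, hspan⟩ := finrank_eq_one_iff'.1 hrank
  have hcoef (j : n) : ∃ c : ℂ, A *ᵥ Pi.single j 1 = c • A *ᵥ x₀ := by
    obtain ⟨c, hc⟩ := hspan ⟨A.mulVecLin (Pi.single j 1), LinearMap.mem_range_self _ _⟩
    exact ⟨c, (congrArg Subtype.val hc).symm⟩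
  choose c hc using hcoef
  have hcR (j : n) : R *ᵥ Pi.single j 1 = c j • R *ᵥ x₀ := by
    have := hker (Pi.single j 1 - c j • x₀) (by rw [mulVec_sub, mulVec_smul, hc, sub_self])
    rwa [mulVec_sub, mulVec_smul, sub_eq_zero] at this
  have hform {M : Matrix n n ℂ} (hM : ∀ j, M *ᵥ Pi.single j 1 = c j • M *ᵥ x₀) :
      M = vecMulVec (M *ᵥ x₀) c := by
    ext i j
    have := congrFun (hM j) i
    rw [mulVec_single_one] at this
    simpa [vecMulVec_apply, mul_comm] using this
  obtain ⟨s, hs⟩ := hA.exists_eq_smul_vecMulVec_star (hform hc)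
  obtain ⟨t, ht⟩ := hR.exists_eq_smul_vecMulVec_star (hform hcR)
  have htr' : (vecMulVec (star c) c).trace * t = 1 := by
    rw [← htr, ht, trace_smul, smul_eq_mul, mul_comm]
  rw [hs, ht, trace_smul, smul_smul, smul_eq_mul, mul_assoc, htr', mul_one]

/-- A vector in the kernel of a nonnegative combination of positive semidefinite matrices is in
the kernel of every matrix with positive coefficient. -/
theorem Matrix.PosSemidef.mulVec_eq_zero_of_sum_smul {n ι : Type*} [Fintype n] [DecidableEq n]
    [Fintype ι] {ρ : ι → Matrix n n ℂ} (hρ : ∀ i, (ρ i).PosSemidef) {k : ι → ℝ}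
    (hk : ∀ i, 0 ≤ k i) {i : ι} (hi : 0 < k i) {x : n → ℂ}
    (hx : (∑ j, k j • ρ j) *ᵥ x = 0) : ρ i *ᵥ x = 0 := by
  rw [← (hρ i).dotProduct_mulVec_zero_iff]
  have hsum : ∑ j, k j • (star x ⬝ᵥ (ρ j *ᵥ x)) = 0 := by
    simpa [sum_mulVec, dotProduct_sum, smul_mulVec, dotProduct_smul] using
      congrArg (star x ⬝ᵥ ·) hx
  have hzero := (Finset.sum_eq_zero_iff_of_nonneg fun j _ ↦
    smul_nonneg (hk j) ((hρ j).dotProduct_mulVec_nonneg x)).1 hsum i (Finset.mem_univ i)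
  exact (smul_eq_zero.1 hzero).resolve_left hi.ne'

/-- A rank-one nonnegative combination of density matrices is a positive real multiple of every
density matrix with positive coefficient. -/
theorem Matrix.exists_pos_eq_smul_of_sum_smul {n ι : Type*} [Fintype n] [DecidableEq n]
    [Fintype ι] {ρ : ι → Matrix n n ℂ} (hρ : ∀ i, (ρ i).PosSemidef) {k : ι → ℝ}
    (hk : ∀ i, 0 ≤ k i) {i : ι} (hi : 0 < k i) (htr : (ρ i).trace = 1)
    {A : Matrix n n ℂ} (hA : A.PosSemidef) (hA0 : A ≠ 0) (hrank : A.rank = 1)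
    (hsum : A = ∑ j, k j • ρ j) : ∃ t : ℝ, 0 < t ∧ A = t • ρ i := by
  have hAtr : 0 < A.trace := hA.trace_nonneg.lt_of_ne' (mt hA.trace_eq_zero_iff.1 hA0)
  obtain ⟨hre, him⟩ := Complex.pos_iff.1 hAtr
  have hcoe : ((A.trace.re : ℝ) : ℂ) = A.trace := Complex.ext (by simp) (by simp [him])
  refine ⟨A.trace.re, hre, ?_⟩
  rw [← Complex.coe_smul, hcoe]
  refine hA.isHermitian.eq_trace_smul_of_rank_eq_one (hρ i).isHermitian hrank htr fun x hx ↦ ?_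
  exact PosSemidef.mulVec_eq_zero_of_sum_smul hρ hk hi (hsum ▸ hx)

/-- EPR steering paradox "2 = 1": two families of positive semidefinite conditional
states summing to the same density matrix `ρ_B`, all nonzero of rank one (pure state
requirement), with no member of the first family a positive multiple of a member of
the second (measurement requirement), admit no local-hidden-state model. -/
theorem steering_paradox_two_eq_one {d K₁ K₂ : ℕ} (hK₁ : 1 ≤ K₁) (hK₂ : 1 ≤ K₂)
    (ρB : Matrix (Fin d) (Fin d) ℂ)
    (hρpsd : ρB.PosSemidef) (hρtr : ρB.trace = 1)
    (τ : Fin K₁ → Matrix (Fin d) (Fin d) ℂ)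
    (σ : Fin K₂ → Matrix (Fin d) (Fin d) ℂ)
    (hτpsd : ∀ a, (τ a).PosSemidef) (hσpsd : ∀ b, (σ b).PosSemidef)
    (hτsum : ∑ a, τ a = ρB) (hσsum : ∑ b, σ b = ρB)
    (hτpure : ∀ a, τ a ≠ 0 ∧ (τ a).rank = 1)
    (hσpure : ∀ b, σ b ≠ 0 ∧ (σ b).rank = 1)
    (hmeas : ∀ a b, ¬ ∃ c : ℝ, 0 < c ∧ τ a = c • σ b) :
    ¬ IsLHSModel τ σ := by
  rintro ⟨L, ρ, w, p₁, p₂, hρ, htr, hw, hwsum, hp₁, hp₂, hp₁sum, hp₂sum, hτ, hσ⟩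
  obtain ⟨ξ, -, hξ⟩ := Finset.exists_lt_of_sum_lt (s := Finset.univ) (f := fun _ ↦ (0 : ℝ))
    (g := w) (by simp [hwsum])
  obtain ⟨a, -, ha⟩ := Finset.exists_lt_of_sum_lt (s := Finset.univ) (f := fun _ ↦ (0 : ℝ))
    (g := (p₁ · ξ)) (by simp [hp₁sum])
  obtain ⟨b, -, hb⟩ := Finset.exists_lt_of_sum_lt (s := Finset.univ) (f := fun _ ↦ (0 : ℝ))
    (g := (p₂ · ξ)) (by simp [hp₂sum])
  obtain ⟨s, hs, hτs⟩ := exists_pos_eq_smul_of_sum_smul hρ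
    (fun j ↦ mul_nonneg (hp₁ a j).1 (hw j).1) (mul_pos ha hξ) (htr ξ) (hτpsd a)
    (hτpure a).1 (hτpure a).2 (hτ a)
  obtain ⟨t, ht, hσt⟩ := exists_pos_eq_smul_of_sum_smul hρ
    (fun j ↦ mul_nonneg (hp₂ b j).1 (hw j).1) (mul_pos hb hξ) (htr ξ) (hσpsd b)
    (hσpure b).1 (hσpure b).2 (hσ b)
  refine hmeas a b ⟨s / t, div_pos hs ht, ?_⟩
  rw [hτs, hσt, smul_smul, div_mul_cancel₀ s ht.ne']

end
end

section
/- Let ρ be a density matrix indexed by Fin dA × Fin dB (an N-qubit state shared between Alice, holding the first factor, and Bob, holding the second). Let {P_a}_{a ∈ Fin K₁} and {Q_b}_{b ∈ Fin K₂} be two projective measurements on ℂ^{dA}, i.e., each P_a and Q_b is a Hermitian idempotent dA × dA matrix, ∑_a P_a = I and ∑_b Q_b = I. Define Bob's unnormalized conditional states τ_a = tr_A[(P_a ⊗ I)ρ] and σ_b = tr_A[(Q_b ⊗ I)ρ]. Assume the pure state requirement: every τ_a and every σ_b is nonzero and has rank one. Assume the measurement requirement: for all a, b there is no real c > 0 with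 τ_a = c • σ_b. Then there exists no local-hidden-state model for (τ, σ): Alice can steer Bob's state, and the LHS description leads to the contradiction '2 = 1'. -/
open Matrix BigOperators ComplexOrder Kronecker

noncomputable section

/-- Partial trace over the first tensor factor:
`(ptrA M) b b' = ∑ a, M (a, b) (a, b')`. -/
def ptrA {A B : Type*} [Fintype A] (M : Matrix (A × B) (A × B) ℂ) : Matrix B B ℂ :=
  fun b b' => ∑ a, M (a, b) (a, b')

/-- Bob's unnormalized conditional state `tr_A[(P ⊗ I) ρ]` after Alice measures `P`. -/
def condState {A B : Type*} [Fintype A] [Fintype B] [DecidableEq B]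
    (P : Matrix A A ℂ) (ρ : Matrix (A × B) (A × B) ℂ) : Matrix B B ℂ :=
  ptrA ((P ⊗ₖ (1 : Matrix B B ℂ)) * ρ)

/-- A rank-one positive semidefinite matrix dominating a positive multiple of a trace-one
positive semidefinite matrix `R` is its own trace times `R`. -/
theorem Matrix.PosSemidef.eq_trace_smul_of_rank_eq_one {B : Type*} [Fintype B] [DecidableEq B]
    {M R : Matrix B B ℂ} (hM : M.PosSemidef) (hR : R.PosSemidef) (hrank : M.rank = 1)
    (htr : R.trace = 1) {c : ℝ} (hc : 0 < c) (hle : (M - c • R).PosSemidef) :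
    M = M.trace • R := by
  obtain ⟨u, v, rfl⟩ : ∃ u v : B → ℂ, M = vecMulVec u v := by
    rw [Matrix.rank, finrank_eq_one_iff'] at hrank
    obtain ⟨⟨u, _⟩, _, hu⟩ := hrank
    choose k hk using fun j => hu ⟨M.mulVecLin (Pi.single j 1), LinearMap.mem_range_self _ _⟩
    refine ⟨u, k, ?_⟩
    ext i j
    have := congrFun (congrArg Subtype.val (hk j)) i
    simpa [vecMulVec_apply, mul_comm] using this.symm
  set M := vecMulVec u v with hMdef
  have sandwich : ∀ X : Matrix B B ℂ, M * X * M = (v ⬝ᵥ (X *ᵥ u)) • M := by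
    intro X
    rw [hMdef, Matrix.mul_assoc, mul_vecMulVec, vecMulVec_mul_vecMulVec, vecMulVec_smul]
  have hMtr : M.trace = v ⬝ᵥ u := by rw [hMdef, trace_vecMulVec, dotProduct_comm]
  have hMM : M * M = M.trace • M := by
    simpa [hMtr] using sandwich 1
  have hM0 : M ≠ 0 := by
    intro h
    simp [h] at hrank
  have ht : M.trace ≠ 0 := fun h => hM0 (hM.trace_eq_zero_iff.mp h)
  have hker : ∀ x, M *ᵥ x = 0 → R *ᵥ x = 0 := by
    intro x hx
    have h1 := hle.dotProduct_mulVec_nonneg x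
    have h2 := hR.dotProduct_mulVec_nonneg x
    rw [sub_mulVec, hx, smul_mulVec, zero_sub, dotProduct_neg, dotProduct_smul] at h1
    have h3 : c • (star x ⬝ᵥ R *ᵥ x) ≤ 0 := neg_nonneg.mp h1
    have h4 : star x ⬝ᵥ R *ᵥ x ≤ 0 := by
      have h := smul_le_smul_of_nonneg_left h3 (inv_nonneg.mpr hc.le)
      rwa [inv_smul_smul₀ hc.ne', smul_zero] at h
    exact (hR.dotProduct_mulVec_zero_iff x).mp (le_antisymm h4 h2)
  have hRM : R * M = M.trace • R := by
    refine Matrix.ext_of_mulVec_single fun j => ?_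
    have := hker (M *ᵥ Pi.single j 1 - M.trace • Pi.single j 1) (by
      rw [mulVec_sub, mulVec_mulVec, hMM, smul_mulVec, mulVec_smul, sub_self])
    rw [mulVec_sub, mulVec_mulVec, mulVec_smul, sub_eq_zero] at this
    rw [this, smul_mulVec]
  have hMR : M * R = star M.trace • R := by
    simpa [hM.1.eq, hR.1.eq] using congrArg Matrix.conjTranspose hRM
  have key := sandwich R
  rw [hMR, Matrix.smul_mul, hRM] at key
  have hs := congrArg trace key
  simp only [trace_smul, htr, smul_eq_mul, mul_one] at hs
  have hs' : v ⬝ᵥ R *ᵥ u = star M.trace := mul_right_cancel₀ ht hs.symm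
  rw [hs'] at key
  exact (smul_right_injective _ (star_ne_zero.mpr ht) key).symm

/-- In a decomposition of a rank-one matrix into nonnegative multiples of density matrices,
every density matrix of positive weight is proportional to the whole. -/
theorem exists_pos_smul_of_eq_sum {B ι : Type*} [Fintype B] [DecidableEq B] [Fintype ι]
    {M : Matrix B B ℂ} {R : ι → Matrix B B ℂ} {q : ι → ℝ} (hrank : M.rank = 1)
    (hR : ∀ i, (R i).PosSemidef) (hq : ∀ i, 0 ≤ q i) (hM : M = ∑ i, q i • R i)
    {i : ι} (htr : (R i).trace = 1) (hi : 0 < q i) :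
    ∃ t : ℝ, 0 < t ∧ M = t • R i := by
  classical
  have hterm : ∀ j, (q j • R j).PosSemidef := fun j => (hR j).smul (hq j)
  have hMpsd : M.PosSemidef := hM ▸ posSemidef_sum _ fun j _ => hterm j
  have hle : (M - q i • R i).PosSemidef := by
    rw [hM, ← Finset.add_sum_erase _ _ (Finset.mem_univ i), add_sub_cancel_left]
    exact posSemidef_sum _ fun j _ => hterm j
  have hMR := hMpsd.eq_trace_smul_of_rank_eq_one (hR i) hrank htr hi hle
  have htr_ne : M.trace ≠ 0 := by
    intro h
    rw [hMpsd.trace_eq_zero_iff.mp h] at hrank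
    simp at hrank
  obtain ⟨hre, him⟩ := Complex.pos_iff.mp (lt_of_le_of_ne hMpsd.trace_nonneg htr_ne.symm)
  refine ⟨M.trace.re, hre, ?_⟩
  rw [← Complex.coe_smul, show (M.trace.re : ℂ) = M.trace from Complex.ext rfl him]
  exact hMR

/-- A finite family of reals summing to one has a positive member. -/
theorem exists_pos_of_sum_eq_one {ι : Type*} [Fintype ι] {f : ι → ℝ} (h : ∑ i, f i = 1) :
    ∃ i, 0 < f i := by
  by_contra! hf
  linarith [Finset.sum_nonpos fun i (_ : i ∈ Finset.univ) => hf i]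

/-- EPR steering paradox "2 = 1" for an `N`-qubit state `ρ` shared between Alice and
Bob: if Bob's unnormalized conditional states under two projective measurements
`{P_a}` and `{Q_b}` on Alice's side are all nonzero of rank one (pure state
requirement), and no conditional state of the first measurement is a positive
multiple of any conditional state of the second (measurement requirement), then
there is no local-hidden-state model for them. -/
theorem steering_paradox_projective_measurements {dA dB K₁ K₂ : ℕ}
    (ρ : Matrix (Fin dA × Fin dB) (Fin dA × Fin dB) ℂ)
    (hρpsd : ρ.PosSemidef) (hρtr : ρ.trace = 1)
    (P : Fin K₁ → Matrix (Fin dA) (Fin dA) ℂ)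
    (Q : Fin K₂ → Matrix (Fin dA) (Fin dA) ℂ)
    (hPherm : ∀ a, (P a).IsHermitian) (hPidem : ∀ a, P a * P a = P a)
    (hPsum : ∑ a, P a = 1)
    (hQherm : ∀ b, (Q b).IsHermitian) (hQidem : ∀ b, Q b * Q b = Q b)
    (hQsum : ∑ b, Q b = 1)
    (hpureP : ∀ a, condState (P a) ρ ≠ 0 ∧ (condState (P a) ρ).rank = 1)
    (hpureQ : ∀ b, condState (Q b) ρ ≠ 0 ∧ (condState (Q b) ρ).rank = 1)
    (hmeas : ∀ a b, ¬ ∃ c : ℝ, 0 < c ∧ condState (P a) ρ = c • condState (Q b) ρ) :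
    ¬ IsLHSModel (fun a => condState (P a) ρ) (fun b => condState (Q b) ρ) := by
  rintro ⟨L, R, w, p₁, p₂, hR, htr, hw, hwsum, hp₁, hp₂, hp₁sum, hp₂sum, hτ, hσ⟩
  obtain ⟨ξ, hξ⟩ := exists_pos_of_sum_eq_one hwsum
  obtain ⟨a, ha⟩ := exists_pos_of_sum_eq_one (hp₁sum ξ)
  obtain ⟨b, hb⟩ := exists_pos_of_sum_eq_one (hp₂sum ξ)
  obtain ⟨s, hs, hτR⟩ := exists_pos_smul_of_eq_sum (hpureP a).2 hR
    (fun i => mul_nonneg (hp₁ a i).1 (hw i).1) (hτ a) (htr ξ) (mul_pos ha hξ)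
  obtain ⟨t, ht, hσR⟩ := exists_pos_smul_of_eq_sum (hpureQ b).2 hR
    (fun i => mul_nonneg (hp₂ b i).1 (hw i).1) (hσ b) (htr ξ) (mul_pos hb hξ)
  refine hmeas a b ⟨s / t, div_pos hs ht, ?_⟩
  rw [hτR, hσR, smul_smul, div_mul_cancel₀ _ ht.ne']

end
end

section
/- Let θ ∈ (0, π/2), let e₀, e₁ be the standard basis of ℂ², and let w± = cos θ • e₀ ± sin θ • e₁. Define the families τ : Fin 2 → Matrix (Fin 2) (Fin 2) ℂ and σ : Fin 2 → Matrix (Fin 2) (Fin 2) ℂ by τ₀ = cos²θ • e₀e₀†, τ₁ = sin²θ • e₁e₁†, σ₀ = (1/2) • w₊w₊†, σ₁ = (1/2) • w₋w₋† (these are the conditional states of the two-qubit pure entangled state cos θ|00⟩ + sin θ|11⟩ when Alice measures her qubit in the z-basis and in the x-basis, respectively). Then there exists no local-hidden-state model for (τ, σ). This is the EPR steering paradox '2 = 1' for any two-qubit entangled pure state in the 2-setting protocol {ẑ, x̂}. -/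
open Matrix BigOperators ComplexOrder

noncomputable section

/-- Standard basis vector `e_a` of `ℂ²`. -/
def e2 (a : Fin 2) : Fin 2 → ℂ := fun i => if i = a then 1 else 0

/-- `w₊ = cos θ • e₀ + sin θ • e₁`. -/
def wPlus (θ : ℝ) : Fin 2 → ℂ := (Real.cos θ : ℂ) • e2 0 + (Real.sin θ : ℂ) • e2 1

/-- `w₋ = cos θ • e₀ − sin θ • e₁`. -/
def wMinus (θ : ℝ) : Fin 2 → ℂ := (Real.cos θ : ℂ) • e2 0 - (Real.sin θ : ℂ) • e2 1

/-- An off-diagonal entry of a positive semidefinite `2 × 2` matrix vanishes as soon as the product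
of the diagonal entries does. -/
theorem Matrix.PosSemidef.apply_zero_one_eq_zero {M : Matrix (Fin 2) (Fin 2) ℂ}
    (hM : M.PosSemidef) (h : M 0 0 * M 1 1 = 0) : M 0 1 = 0 := by
  have hdet := hM.det_nonneg
  rw [Matrix.det_fin_two, h, ← hM.isHermitian.apply 1 0, zero_sub, Complex.star_def,
    Complex.mul_conj, Left.nonneg_neg_iff, ← Complex.ofReal_zero, Complex.real_le_real] at hdet
  exact Complex.normSq_eq_zero.mp (hdet.antisymm (Complex.normSq_nonneg _))

/-- If a diagonal entry of a nonnegative combination of positive semidefinite matrices vanishes,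
then it vanishes in every term. -/
theorem smul_apply_diag_eq_zero_of_sum_eq_zero {ι B : Type*} [Fintype ι]
    {ρ : ι → Matrix B B ℂ} {c : ι → ℝ} (hρ : ∀ ξ, (ρ ξ).PosSemidef) (hc : ∀ ξ, 0 ≤ c ξ) {i : B}
    (h : (∑ ξ, c ξ • ρ ξ) i i = 0) (ξ : ι) : c ξ = 0 ∨ ρ ξ i i = 0 := by
  simp only [Matrix.sum_apply, Matrix.smul_apply] at h
  rw [Finset.sum_eq_zero_iff_of_nonneg fun ξ _ => smul_nonneg (hc ξ) (hρ ξ).diag_nonneg]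
    at h
  exact smul_eq_zero.mp (h ξ (Finset.mem_univ ξ))

/-- In a local-hidden-state model whose first family consists of multiples of the two basis
projections, the members of the second family are diagonal. -/
theorem IsLHSModel.apply_zero_one_eq_zero {K : ℕ} {τ : Fin 2 → Matrix (Fin 2) (Fin 2) ℂ}
    {σ : Fin K → Matrix (Fin 2) (Fin 2) ℂ} (h : IsLHSModel τ σ) (h₀ : τ 0 1 1 = 0)
    (h₁ : τ 1 0 0 = 0) (b : Fin K) : σ b 0 1 = 0 := by
  obtain ⟨L, ρ, w, p₁, p₂, hρ, -, hw, -, hp₁, -, hsum, -, hτ, hσ⟩ := h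
  have hc : ∀ a ξ, 0 ≤ p₁ a ξ * w ξ := fun a ξ => mul_nonneg (hp₁ a ξ).1 (hw ξ).1
  rw [hτ] at h₀ h₁
  rw [hσ, Matrix.sum_apply]
  refine Finset.sum_eq_zero fun ξ _ => ?_
  rw [Matrix.smul_apply]
  by_cases hwξ : w ξ = 0
  · simp [hwξ]
  rw [(hρ ξ).apply_zero_one_eq_zero, smul_zero]
  rcases smul_apply_diag_eq_zero_of_sum_eq_zero hρ (hc 0) h₀ ξ with h0 | h0
  · rcases smul_apply_diag_eq_zero_of_sum_eq_zero hρ (hc 1) h₁ ξ with h1 | h1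
    · have := hsum ξ
      rw [Fin.sum_univ_two, (mul_eq_zero.mp h0).resolve_right hwξ,
        (mul_eq_zero.mp h1).resolve_right hwξ] at this
      norm_num at this
    · rw [h1, zero_mul]
  · rw [h0, mul_zero]

/-- EPR steering paradox "2 = 1" for any two-qubit entangled pure state
`cos θ |00⟩ + sin θ |11⟩` with `θ ∈ (0, π/2)` in the 2-setting protocol `{ẑ, x̂}`:
the conditional states `τ = (cos²θ e₀e₀†, sin²θ e₁e₁†)` and
`σ = ((1/2) w₊w₊†, (1/2) w₋w₋†)` admit no local-hidden-state model. -/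
theorem steering_paradox_two_qubit_pure {θ : ℝ} (hθ : θ ∈ Set.Ioo 0 (Real.pi / 2)) :
    ¬ IsLHSModel
        ![(Real.cos θ ^ 2) • outerProd (e2 0), (Real.sin θ ^ 2) • outerProd (e2 1)]
        ![(1 / 2 : ℝ) • outerProd (wPlus θ), (1 / 2 : ℝ) • outerProd (wMinus θ)] := by
  intro h
  have h01 := h.apply_zero_one_eq_zero (by simp [outerProd, e2]) (by simp [outerProd, e2]) 0
  have hc : Real.cos θ ≠ 0 :=
    (Real.cos_pos_of_mem_Ioo ⟨by linarith [hθ.1, Real.pi_pos], hθ.2⟩).ne'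
  have hs : Real.sin θ ≠ 0 :=
    (Real.sin_pos_of_pos_of_lt_pi hθ.1 (by linarith [hθ.2, Real.pi_pos])).ne'
  simp [outerProd, wPlus, e2, -Complex.ofReal_cos, -Complex.ofReal_sin, hc, hs] at h01

end
end

section
/- Let θ ∈ ℝ. In (ℂ²)^{⊗4}, with Alice holding qubits 1,2 and Bob holding qubits 3,4, define the linear cluster states |LC₄⟩ = (1/2)(|0000⟩ + |1100⟩ + |0011⟩ − |1111⟩) and |LC₄′⟩ = (1/2)(|0100⟩ + |1000⟩ + |0111⟩ − |1011⟩), and the state ρ(θ) = cos²θ • |LC₄⟩⟨LC₄| + sin²θ • |LC₄′⟩⟨LC₄′|. Let the first measurement consist of the four projectors onto |a b⟩ (a, b ∈ {0,1}) on Alice's two qubits, and let the second measurement consist of the four projectors onto y_s ⊗ x_t, where y_± = (e₀ ± i e₁)/√2 and x_± = (e₀ ± e₁)/√2, s, t ∈ {+, −}. Then Bob's eight unnormalized conditional states are: tr_A[(|00⟩⟨00| ⊗ I)ρ(θ)] = (cos²θ/4) u₊u₊†, tr_A[(|01⟩⟨01| ⊗ I)ρ(θ)] = (sin²θ/4) u₊u₊†,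 tr_A[(|10⟩⟨10| ⊗ I)ρ(θ)] = (sin²θ/4) u₋u₋†, tr_A[(|11⟩⟨11| ⊗ I)ρ(θ)] = (cos²θ/4) u₋u₋†, where u± = e₀⊗e₀ ± e₁⊗e₁; and for the second measurement, the conditional states for (y₊, x₊) and (y₋, x₋) both equal (1/8) w w†, while those for (y₊, x₋) and (y₋, x₊) both equal (1/8) w̄ w̄†, where w = e₀⊗e₀ + i e₁⊗e₁ and w̄ = e₀⊗e₀ − i e₁⊗e₁. -/
open Matrix BigOperators ComplexOrder Kronecker

noncomputable section

/-- Tensor product of vectors: `(x ⊗ y) (a, b) = x a * y b`. -/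
def tvec {A B : Type*} (x : A → ℂ) (y : B → ℂ) : A × B → ℂ :=
  fun p => x p.1 * y p.2

/-- Two-qubit computational basis vector `|ab⟩ = e_a ⊗ e_b`. -/
def ket2 (a b : Fin 2) : Fin 2 × Fin 2 → ℂ := tvec (e2 a) (e2 b)

/-- Four-qubit computational basis vector `|abcd⟩`, with Alice's two qubits first. -/
def ket4 (a b c d : Fin 2) : (Fin 2 × Fin 2) × (Fin 2 × Fin 2) → ℂ :=
  tvec (ket2 a b) (ket2 c d)

/-- The linear cluster state `|LC₄⟩ = (1/2)(|0000⟩ + |1100⟩ + |0011⟩ − |1111⟩)`. -/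
def LC4 : (Fin 2 × Fin 2) × (Fin 2 × Fin 2) → ℂ :=
  (1 / 2 : ℂ) • (ket4 0 0 0 0 + ket4 1 1 0 0 + ket4 0 0 1 1 - ket4 1 1 1 1)

/-- The linear cluster state `|LC₄′⟩ = (1/2)(|0100⟩ + |1000⟩ + |0111⟩ − |1011⟩)`. -/
def LC4' : (Fin 2 × Fin 2) × (Fin 2 × Fin 2) → ℂ :=
  (1 / 2 : ℂ) • (ket4 0 1 0 0 + ket4 1 0 0 0 + ket4 0 1 1 1 - ket4 1 0 1 1)

/-- The 4-qubit mixed state `ρ(θ) = cos²θ |LC₄⟩⟨LC₄| + sin²θ |LC₄′⟩⟨LC₄′|`. -/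
def rhoLC (θ : ℝ) : Matrix ((Fin 2 × Fin 2) × (Fin 2 × Fin 2))
    ((Fin 2 × Fin 2) × (Fin 2 × Fin 2)) ℂ :=
  (Real.cos θ ^ 2) • outerProd LC4 + (Real.sin θ ^ 2) • outerProd LC4'

/-- `y₊ = (e₀ + i e₁)/√2`, `y₋ = (e₀ − i e₁)/√2`. -/
def yv (s : Bool) : Fin 2 → ℂ :=
  fun i => (e2 0 i + (if s then Complex.I else -Complex.I) * e2 1 i) / (Real.sqrt 2 : ℂ)

/-- `x₊ = (e₀ + e₁)/√2`, `x₋ = (e₀ − e₁)/√2`. -/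
def xv (t : Bool) : Fin 2 → ℂ :=
  fun i => (e2 0 i + (if t then 1 else -1) * e2 1 i) / (Real.sqrt 2 : ℂ)

/-- `u± = e₀⊗e₀ ± e₁⊗e₁`. -/
def uP : Fin 2 × Fin 2 → ℂ := ket2 0 0 + ket2 1 1
def uM : Fin 2 × Fin 2 → ℂ := ket2 0 0 - ket2 1 1

/-- `w = e₀⊗e₀ + i e₁⊗e₁` and `w̄ = e₀⊗e₀ − i e₁⊗e₁`. -/
def wv : Fin 2 × Fin 2 → ℂ := ket2 0 0 + Complex.I • ket2 1 1
def wb : Fin 2 × Fin 2 → ℂ := ket2 0 0 - Complex.I • ket2 1 1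

/-- The partial inner product `(⟨v| ⊗ I) ψ`. -/
def partialBra {A B : Type*} [Fintype A] (v : A → ℂ) (ψ : A × B → ℂ) : B → ℂ :=
  fun b => ∑ a, (starRingEnd ℂ) (v a) * ψ (a, b)

lemma condState_add {A B : Type*} [Fintype A] [Fintype B] [DecidableEq B]
    (P : Matrix A A ℂ) (ρ σ : Matrix (A × B) (A × B) ℂ) :
    condState P (ρ + σ) = condState P ρ + condState P σ := by
  ext b b'
  simp [condState, ptrA, Matrix.mul_add, Finset.sum_add_distrib]

lemma condState_smul {A B : Type*} [Fintype A] [Fintype B] [DecidableEq B]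
    (P : Matrix A A ℂ) (r : ℝ) (ρ : Matrix (A × B) (A × B) ℂ) :
    condState P (r • ρ) = r • condState P ρ := by
  ext b b'
  simp [condState, ptrA, Finset.mul_sum]

lemma condState_outerProd {A B : Type*} [Fintype A] [Fintype B] [DecidableEq B]
    (v : A → ℂ) (ψ : A × B → ℂ) :
    condState (outerProd v) (outerProd ψ) = outerProd (partialBra v ψ) := by
  ext b b'
  simp only [condState, ptrA, outerProd, partialBra, Matrix.mul_apply, kroneckerMap_apply,
    Matrix.one_apply, Fintype.sum_prod_type, mul_ite, mul_one, mul_zero, ite_mul, zero_mul,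
    Finset.sum_ite_eq, Finset.mem_univ, if_true, map_sum, map_mul, Complex.conj_conj,
    Finset.sum_mul_sum]
  rw [Finset.sum_comm]
  refine Finset.sum_congr rfl fun a _ => Finset.sum_congr rfl fun a' _ => ?_
  ring

lemma outerProd_smul {d : Type*} [Fintype d] (c : ℂ) (v : d → ℂ) :
    outerProd (c • v) = Complex.normSq c • outerProd v := by
  ext j k
  simp only [outerProd, Pi.smul_apply, Matrix.smul_apply, smul_eq_mul, map_mul,
    Complex.real_smul, Complex.normSq_eq_conj_mul_self]
  ring

/-- If Alice's outcome `v` leaves Bob in multiples of `u` for both components of the mixture,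
his conditional state is a multiple of `u u†`. -/
lemma condState_rhoLC {θ : ℝ} {v u : Fin 2 × Fin 2 → ℂ} {c c' : ℂ} {r : ℝ}
    (h : partialBra v LC4 = c • u) (h' : partialBra v LC4' = c' • u)
    (hr : Real.cos θ ^ 2 * Complex.normSq c + Real.sin θ ^ 2 * Complex.normSq c' = r) :
    condState (outerProd v) (rhoLC θ) = r • outerProd u := by
  rw [rhoLC, condState_add, condState_smul, condState_smul, condState_outerProd,
    condState_outerProd, h, h', outerProd_smul, outerProd_smul, smul_smul, smul_smul,
    ← add_smul, hr]

lemma ket4_apply (a b c d i j : Fin 2) (q : Fin 2 × Fin 2) :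
    ket4 a b c d ((i, j), q) =
      (if i = a then 1 else 0) * (if j = b then 1 else 0) * ket2 c d q := rfl

lemma partialBra_LC4 (v : Fin 2 × Fin 2 → ℂ) :
    partialBra v LC4 = (1 / 2 : ℂ) •
      (((starRingEnd ℂ) (v (0, 0)) + (starRingEnd ℂ) (v (1, 1))) • ket2 0 0 +
        ((starRingEnd ℂ) (v (0, 0)) - (starRingEnd ℂ) (v (1, 1))) • ket2 1 1) := by
  funext b
  simp [partialBra, LC4, ket4_apply, Fintype.sum_prod_type]
  ring

lemma partialBra_LC4' (v : Fin 2 × Fin 2 → ℂ) :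
    partialBra v LC4' = (1 / 2 : ℂ) •
      (((starRingEnd ℂ) (v (0, 1)) + (starRingEnd ℂ) (v (1, 0))) • ket2 0 0 +
        ((starRingEnd ℂ) (v (0, 1)) - (starRingEnd ℂ) (v (1, 0))) • ket2 1 1) := by
  funext b
  simp [partialBra, LC4', ket4_apply, Fintype.sum_prod_type]
  ring

lemma tvec_yv_xv_apply (s t : Bool) (i j : Fin 2) :
    tvec (yv s) (xv t) (i, j) =
      (e2 0 i + (if s then Complex.I else -Complex.I) * e2 1 i) *
        (e2 0 j + (if t then 1 else -1) * e2 1 j) / 2 := by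
  have h : (Real.sqrt 2 : ℂ) * Real.sqrt 2 = 2 := by
    rw [← Complex.ofReal_mul, Real.mul_self_sqrt zero_le_two, Complex.ofReal_ofNat]
  simp only [tvec, yv, xv, div_mul_div_comm, h]

lemma ket2_apply (a b i j : Fin 2) :
    ket2 a b (i, j) = (if i = a then 1 else 0) * (if j = b then 1 else 0) := rfl

/-- Bob's eight unnormalized conditional states of the 4-qubit mixed state `ρ(θ)`
under Alice's computational-basis (ẑẑ) measurement and her (ŷx̂) measurement. -/
theorem four_qubit_conditional_states (θ : ℝ) :
    condState (outerProd (ket2 0 0)) (rhoLC θ) = (Real.cos θ ^ 2 / 4) • outerProd uP ∧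
    condState (outerProd (ket2 0 1)) (rhoLC θ) = (Real.sin θ ^ 2 / 4) • outerProd uP ∧
    condState (outerProd (ket2 1 0)) (rhoLC θ) = (Real.sin θ ^ 2 / 4) • outerProd uM ∧
    condState (outerProd (ket2 1 1)) (rhoLC θ) = (Real.cos θ ^ 2 / 4) • outerProd uM ∧
    condState (outerProd (tvec (yv true) (xv true))) (rhoLC θ) = (1 / 8 : ℝ) • outerProd wv ∧
    condState (outerProd (tvec (yv true) (xv false))) (rhoLC θ) = (1 / 8 : ℝ) • outerProd wb ∧
    condState (outerProd (tvec (yv false) (xv true))) (rhoLC θ) = (1 / 8 : ℝ) • outerProd wb ∧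
    condState (outerProd (tvec (yv false) (xv false))) (rhoLC θ) = (1 / 8 : ℝ) • outerProd wv := by
  have hcs := Real.cos_sq_add_sin_sq θ
  refine ⟨condState_rhoLC (c := 1 / 2) (c' := 0) ?_ ?_ ?_,
    condState_rhoLC (c := 0) (c' := 1 / 2) ?_ ?_ ?_,
    condState_rhoLC (c := 0) (c' := 1 / 2) ?_ ?_ ?_,
    condState_rhoLC (c := 1 / 2) (c' := 0) ?_ ?_ ?_,
    condState_rhoLC (c := (1 - Complex.I) / 4) (c' := (1 - Complex.I) / 4) ?_ ?_ ?_,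
    condState_rhoLC (c := (1 + Complex.I) / 4) (c' := -(1 + Complex.I) / 4) ?_ ?_ ?_,
    condState_rhoLC (c := (1 + Complex.I) / 4) (c' := (1 + Complex.I) / 4) ?_ ?_ ?_,
    condState_rhoLC (c := (1 - Complex.I) / 4) (c' := -(1 - Complex.I) / 4) ?_ ?_ ?_⟩
  all_goals first
    | rw [partialBra_LC4] | rw [partialBra_LC4'] | skip
  all_goals first
    | (funext b
       simp [tvec_yv_xv_apply, ket2_apply, e2, uP, uM, wv, wb, Complex.conj_ofNat] <;>
       grind [Complex.I_mul_I])
    | (simp [Complex.normSq_apply]; linarith)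

end
end

section
/- Let K ≥ 1, let {e_i⁺, e_i⁻}_{i ∈ Fin K} be an orthonormal basis of ℂ^{2K}, and let β₁, β₂ ∈ ℝ with sin(β₁ − β₂) ≠ 0 and cos(β₁ − β₂) ≠ 0. For k = 1, 2, define the Bell-like measurement on ℂ^{2K} consisting of the 2K rank-one projectors onto u_i⁺(β_k) = cos β_k • e_i⁺ + sin β_k • e_i⁻ and u_i⁻(β_k) = sin β_k • e_i⁺ − cos β_k • e_i⁻, i ∈ Fin K. Let ρ be a density matrix indexed by Fin (2K) × Fin dB such that: (pure state requirement) every unnormalized conditional state of ρ under either Bell-like measurement has rank at most one; and (measurement requirement) no nonzero conditional state arising from the first measurement is a nonnegative real multiple of a nonzero conditional state arising from the second measurement. Then rank ρ ≤ K. (For an N-qubit state with Alice holding M qubits, 2K = 2^M, so the maximal rank of ρ admitting the steering paradox with Bell-like measurements is 2^{M−1}.) -/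
open Matrix BigOperators ComplexOrder Kronecker

noncomputable section

/-- The Bell-like basis vector at angle `β`:
`u_i⁺(β) = cos β • e_i⁺ + sin β • e_i⁻` (for `s = true`) and
`u_i⁻(β) = sin β • e_i⁺ − cos β • e_i⁻` (for `s = false`). -/
def bellVec {K : ℕ} (ep em : Fin K → Fin (2 * K) → ℂ) (β : ℝ) (i : Fin K) :
    Bool → (Fin (2 * K) → ℂ)
  | true => (Real.cos β : ℂ) • ep i + (Real.sin β : ℂ) • em i
  | false => (Real.sin β : ℂ) • ep i - (Real.cos β : ℂ) • em i

/-- A matrix of rank at most one is an outer product. -/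
lemma exists_eq_vecMulVec_of_rank_le_one {m n : Type*} [Fintype m] [Fintype n]
    (A : Matrix m n ℂ) (h : A.rank ≤ 1) : ∃ a x, A = vecMulVec a x := by
  classical
  obtain ⟨v, hv⟩ := finrank_le_one_iff.mp h
  choose c hc using hv
  refine ⟨v, fun j => c ⟨A.mulVecLin (Pi.single j 1), LinearMap.mem_range_self _ _⟩, ?_⟩
  ext i j
  have := congrFun (congrArg Subtype.val
    (hc ⟨A.mulVecLin (Pi.single j 1), LinearMap.mem_range_self _ _⟩)) i
  simp only [Submodule.coe_smul, Pi.smul_apply, smul_eq_mul, mulVecLin_apply,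
    mulVec_single_one, col_apply] at this
  rw [vecMulVec_apply, ← this, mul_comm]
  simp only [mulVecLin_apply, mulVec_single_one]

/-- Entries of the Gram matrix `vecMulVec a x * (vecMulVec a x)ᴴ`. -/
lemma vecMulVec_mul_conjTranspose_apply {m n : Type*} [Fintype n]
    (a : m → ℂ) (x : n → ℂ) (i j : m) :
    (vecMulVec a x * (vecMulVec a x)ᴴ) i j
      = ((∑ r, Complex.normSq (x r) : ℝ) : ℂ) * (a i * star (a j)) := by
  simp only [mul_apply, conjTranspose_apply, vecMulVec_apply, Complex.ofReal_sum,
    Finset.sum_mul, Complex.normSq_eq_conj_mul_self, star_mul', Complex.star_def]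
  exact Finset.sum_congr rfl fun r _ => by ring

/-- If `A`, `B` and a combination `p A + q B` with `p, q ≠ 0` have rank at most one, then `A` and
`B` have a common row direction, unless `A` and `p A + q B` have a common column direction. -/
lemma exists_common_row {m n : Type*} [Fintype m] [Fintype n]
    {A B : Matrix m n ℂ} {p q : ℂ} (hp : p ≠ 0) (hq : q ≠ 0)
    (hA : A.rank ≤ 1) (hB : B.rank ≤ 1) (hC : (p • A + q • B).rank ≤ 1)
    (hne : A * Aᴴ ≠ 0 → (p • A + q • B) * (p • A + q • B)ᴴ ≠ 0 → ∀ c : ℝ, 0 ≤ c →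
      A * Aᴴ ≠ c • ((p • A + q • B) * (p • A + q • B)ᴴ)) :
    ∃ (g : n → ℂ) (a b : m → ℂ), A = vecMulVec a g ∧ B = vecMulVec b g := by
  obtain ⟨a, x, rfl⟩ := exists_eq_vecMulVec_of_rank_le_one A hA
  obtain ⟨b, y, rfl⟩ := exists_eq_vecMulVec_of_rank_le_one B hB
  obtain ⟨c, z, hcz⟩ := exists_eq_vecMulVec_of_rank_le_one _ hC
  have hpt : ∀ i r, p * (a i * x r) + q * (b i * y r) = c i * z r := fun i r => by
    simpa [vecMulVec_apply] using congrFun (congrFun hcz i) r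
  rw [hcz] at hne
  by_cases hA0 : vecMulVec a x = 0
  · exact ⟨y, 0, b, by simp [hA0], rfl⟩
  by_cases hC0 : vecMulVec c z = 0
  · refine ⟨x, a, -(p / q) • a, rfl, ?_⟩
    ext i r
    have h1 := hpt i r
    have h2 := congrFun (congrFun hC0 i) r
    simp only [vecMulVec_apply, Matrix.zero_apply] at h2
    simp only [vecMulVec_apply, Pi.smul_apply, smul_eq_mul]
    rw [h2] at h1
    field_simp
    linear_combination h1
  have hc0 : c ≠ 0 := by rintro rfl; exact hC0 (zero_vecMulVec z)
  have hz0 : z ≠ 0 := by rintro rfl; exact hC0 (by ext; simp [vecMulVec_apply])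
  obtain ⟨j₀, hj₀⟩ := Function.ne_iff.mp hc0
  simp only [Pi.zero_apply] at hj₀
  by_cases hac : ∀ j, a j * c j₀ = a j₀ * c j
  · exfalso
    obtain ⟨r₀, hr₀⟩ := Function.ne_iff.mp hz0
    set Z : ℝ := ∑ r, Complex.normSq (z r) with hZ
    set X : ℝ := ∑ r, Complex.normSq (x r) with hX
    have hZpos : 0 < Z := Finset.sum_pos' (fun r _ => Complex.normSq_nonneg _)
      ⟨r₀, Finset.mem_univ _, Complex.normSq_pos.mpr hr₀⟩
    have hXnn : 0 ≤ X := Finset.sum_nonneg fun r _ => Complex.normSq_nonneg _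
    obtain ⟨t, ht⟩ : ∃ t : ℂ, ∀ j, a j = t * c j :=
      ⟨a j₀ / c j₀, fun j => by field_simp; linear_combination hac j⟩
    refine hne (mt self_mul_conjTranspose_eq_zero.mp hA0)
      (mt self_mul_conjTranspose_eq_zero.mp hC0) (X * Complex.normSq t / Z)
      (div_nonneg (mul_nonneg hXnn (Complex.normSq_nonneg _)) hZpos.le) ?_
    ext i j
    have hZ0 : (Z : ℂ) ≠ 0 := by exact_mod_cast hZpos.ne'
    rw [Matrix.smul_apply, vecMulVec_mul_conjTranspose_apply, vecMulVec_mul_conjTranspose_apply,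
      ← hZ, ← hX, ht i, ht j, Complex.real_smul]
    push_cast
    rw [Complex.normSq_eq_conj_mul_self, star_mul', Complex.star_def]
    field_simp
  · push Not at hac
    obtain ⟨j₁, hj₁⟩ := hac
    have hd : a j₁ * c j₀ - a j₀ * c j₁ ≠ 0 := sub_ne_zero.mpr hj₁
    have hx : ∀ r, x r
        = -(q * (b j₁ * c j₀ - b j₀ * c j₁)) / (p * (a j₁ * c j₀ - a j₀ * c j₁)) * y r := by
      intro r
      rw [div_mul_eq_mul_div, eq_div_iff (mul_ne_zero hp hd)]
      linear_combination c j₀ * hpt j₁ r - c j₁ * hpt j₀ r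
    refine ⟨y, (-(q * (b j₁ * c j₀ - b j₀ * c j₁))
      / (p * (a j₁ * c j₀ - a j₀ * c j₁))) • a, b, ?_, rfl⟩
    ext i r
    simp only [vecMulVec_apply, Pi.smul_apply, smul_eq_mul]
    rw [hx r]
    ring

/-- The contraction `(u† ⊗ I) S` of the columns of `S` with `u` on the first tensor factor. -/
def contractFst {A B R : Type*} [Fintype A] (S : Matrix (A × B) R ℂ) (u : A → ℂ) :
    Matrix B R ℂ :=
  of fun b r => ∑ a, star (u a) * S (a, b) r

lemma condState_outerProd_s12 {A B R : Type*} [Fintype A] [Fintype B] [DecidableEq B] [Fintype R]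
    (S : Matrix (A × B) R ℂ) (u : A → ℂ) :
    condState (outerProd u) (S * Sᴴ) = contractFst S u * (contractFst S u)ᴴ := by
  ext b b'
  simp only [condState, ptrA, contractFst, outerProd, mul_apply, kroneckerMap_apply,
    one_apply, Fintype.sum_prod_type, conjTranspose_apply, of_apply, mul_ite, mul_one, mul_zero,
    ite_mul, zero_mul, Finset.sum_ite_eq, Finset.mem_univ, if_true]
  simp only [star_sum, star_mul', Finset.sum_mul, Finset.mul_sum, Complex.star_def,
    Complex.conj_conj]
  conv_rhs => rw [Finset.sum_comm]
  refine Finset.sum_congr rfl fun a _ => ?_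
  rw [Finset.sum_comm]
  exact Finset.sum_congr rfl fun r _ => Finset.sum_congr rfl fun a' _ => by ring

lemma contractFst_add_smul {A B R : Type*} [Fintype A] (S : Matrix (A × B) R ℂ)
    (p q : ℝ) (u v : A → ℂ) :
    contractFst S ((p : ℂ) • u + (q : ℂ) • v)
      = (p : ℂ) • contractFst S u + (q : ℂ) • contractFst S v := by
  ext b r
  simp [contractFst, add_mul, Finset.sum_add_distrib, Finset.mul_sum, mul_assoc]

lemma bellVec_true_eq {K : ℕ} (ep em : Fin K → Fin (2 * K) → ℂ) (β₁ β₂ : ℝ) (i : Fin K) :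
    bellVec ep em β₂ i true = (Real.cos (β₁ - β₂) : ℂ) • bellVec ep em β₁ i true
      + (Real.sin (β₁ - β₂) : ℂ) • bellVec ep em β₁ i false := by
  have hc : Real.cos β₂ = Real.cos (β₁ - β₂) * Real.cos β₁ + Real.sin (β₁ - β₂) * Real.sin β₁ := by
    rw [mul_comm, mul_comm (Real.sin _), ← Real.cos_sub, sub_sub_cancel]
  have hs : Real.sin β₂ = Real.cos (β₁ - β₂) * Real.sin β₁ - Real.sin (β₁ - β₂) * Real.cos β₁ := by
    linear_combination (Real.sin_sub β₁ (β₁ - β₂)) - congrArg Real.sin (sub_sub_cancel β₁ β₂)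
  ext a
  simp only [bellVec, Pi.add_apply, Pi.sub_apply, Pi.smul_apply, smul_eq_mul]
  rw [hc, hs]
  push_cast
  ring

/-- Completeness of the Bell-like basis. -/
lemma sum_bellVec_mul_star {K : ℕ} (ep em : Fin K → Fin (2 * K) → ℂ)
    (hpp : ∀ i j, star (ep i) ⬝ᵥ ep j = if i = j then 1 else 0)
    (hmm : ∀ i j, star (em i) ⬝ᵥ em j = if i = j then 1 else 0)
    (hpm : ∀ i j, star (ep i) ⬝ᵥ em j = 0)
    (hmp : ∀ i j, star (em i) ⬝ᵥ ep j = 0) (β : ℝ) (a a' : Fin (2 * K)) :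
    ∑ i, (bellVec ep em β i true a * star (bellVec ep em β i true a')
      + bellVec ep em β i false a * star (bellVec ep em β i false a'))
      = if a = a' then 1 else 0 := by
  let W : Matrix (Fin K × Bool) (Fin (2 * K)) ℂ := of fun k => star (bellVec ep em β k.1 k.2)
  have hcs : (Real.cos β : ℂ) * Real.cos β + (Real.sin β : ℂ) * Real.sin β = 1 := by
    norm_cast
    linear_combination Real.sin_sq_add_cos_sq β
  have hW : W * Wᴴ = 1 := by
    ext ⟨i, s⟩ ⟨j, t⟩
    have : (W * Wᴴ) (i, s) (j, t) = star (bellVec ep em β i s) ⬝ᵥ bellVec ep em β j t := by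
      simp [W, mul_apply, dotProduct]
    rw [this, one_apply]
    cases s <;> cases t <;> by_cases hij : i = j <;>
      simp [bellVec, hpp, hmm, hpm, hmp, hij, star_smul, -Complex.ofReal_cos, -Complex.ofReal_sin]
    all_goals first | linear_combination hcs | ring
  have hW' : Wᴴ * W = 1 := (mul_eq_one_comm_of_card_eq _ _ _ (by simp [mul_comm])).mp hW
  have := congrFun (congrFun hW' a) a'
  simpa [W, mul_apply, one_apply, Fintype.sum_prod_type] using this

/-- For Bell-like measurements at angles `β₁, β₂` (with `sin (β₁ − β₂) ≠ 0` and
`cos (β₁ − β₂) ≠ 0`) built on an orthonormal basis `{e_i⁺, e_i⁻}` of `ℂ^{2K}`, any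
density matrix `ρ` satisfying the pure state requirement (all conditional states have
rank at most one) and the measurement requirement (no nonzero conditional state of the
first measurement is a nonnegative multiple of a nonzero one of the second) has
`rank ρ ≤ K`: the maximal rank admitting the steering paradox is `2^{M−1}`. -/
theorem bellLike_steering_rank_bound {K dB : ℕ} (hK : 1 ≤ K)
    (ep em : Fin K → Fin (2 * K) → ℂ)
    (hpp : ∀ i j, star (ep i) ⬝ᵥ ep j = if i = j then 1 else 0)
    (hmm : ∀ i j, star (em i) ⬝ᵥ em j = if i = j then 1 else 0)
    (hpm : ∀ i j, star (ep i) ⬝ᵥ em j = 0)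
    (hmp : ∀ i j, star (em i) ⬝ᵥ ep j = 0)
    (β₁ β₂ : ℝ)
    (hsin : Real.sin (β₁ - β₂) ≠ 0) (hcos : Real.cos (β₁ - β₂) ≠ 0)
    (ρ : Matrix (Fin (2 * K) × Fin dB) (Fin (2 * K) × Fin dB) ℂ)
    (hρpsd : ρ.PosSemidef) (hρtr : ρ.trace = 1)
    (hpure₁ : ∀ i s, (condState (outerProd (bellVec ep em β₁ i s)) ρ).rank ≤ 1)
    (hpure₂ : ∀ j t, (condState (outerProd (bellVec ep em β₂ j t)) ρ).rank ≤ 1)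
    (hmeas : ∀ i s j t,
      condState (outerProd (bellVec ep em β₁ i s)) ρ ≠ 0 →
      condState (outerProd (bellVec ep em β₂ j t)) ρ ≠ 0 →
      ∀ c : ℝ, 0 ≤ c →
        condState (outerProd (bellVec ep em β₁ i s)) ρ
          ≠ c • condState (outerProd (bellVec ep em β₂ j t)) ρ) :
    ρ.rank ≤ K := by
  obtain ⟨N, v, hv⟩ := posSemidef_iff_eq_sum_vecMulVec.mp hρpsd
  let S : Matrix (Fin (2 * K) × Fin dB) (Fin N) ℂ := of fun x r => v r x
  have hS : ρ = S * Sᴴ := by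
    rw [hv]
    ext x y
    simp [S, mul_apply, Matrix.sum_apply, vecMulVec_apply]
  clear_value S
  subst hS
  simp only [condState_outerProd_s12, rank_self_mul_conjTranspose] at hpure₁ hpure₂ hmeas ⊢
  have hrow : ∀ i, ∃ (g : Fin N → ℂ) (a b : Fin dB → ℂ),
      contractFst S (bellVec ep em β₁ i true) = vecMulVec a g ∧
      contractFst S (bellVec ep em β₁ i false) = vecMulVec b g := by
    intro i
    have hcomb := congrArg (contractFst S) (bellVec_true_eq ep em β₁ β₂ i)
    rw [contractFst_add_smul] at hcomb
    refine exists_common_row (p := (Real.cos (β₁ - β₂) : ℂ)) (q := (Real.sin (β₁ - β₂) : ℂ))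
      (by exact_mod_cast hcos) (by exact_mod_cast hsin) (hpure₁ i true) (hpure₁ i false) ?_ ?_
    · rw [← hcomb]; exact hpure₂ i true
    · rw [← hcomb]; exact hmeas i true i true
  choose g p q hp hq using hrow
  have hfac : S = (of fun x i => bellVec ep em β₁ i true x.1 * p i x.2
      + bellVec ep em β₁ i false x.1 * q i x.2 : Matrix (Fin (2 * K) × Fin dB) (Fin K) ℂ)
      * of g := by
    ext ⟨a, b⟩ r
    have hp' : ∀ i, p i b * g i r
        = ∑ a', star (bellVec ep em β₁ i true a') * S (a', b) r := fun i =>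
      (congrFun (congrFun (hp i) b) r).symm
    have hq' : ∀ i, q i b * g i r
        = ∑ a', star (bellVec ep em β₁ i false a') * S (a', b) r := fun i =>
      (congrFun (congrFun (hq i) b) r).symm
    calc S (a, b) r = ∑ a', (if a = a' then 1 else 0) * S (a', b) r := by simp
      _ = _ := by
        simp only [← sum_bellVec_mul_star ep em hpp hmm hpm hmp β₁, mul_apply, of_apply,
          add_mul, mul_assoc, hp', hq', Finset.sum_mul, Finset.mul_sum,
          ← Finset.sum_add_distrib]
        exact Finset.sum_comm
  rw [hfac]
  exact (rank_mul_le_left _ _).trans ((rank_le_card_width _).trans (by simp))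

end
end
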